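/- For integers r ≥ 1 and 0 ≤ m ≤ r−1, in ℚ[[q]]: Σ_{(λ^{(1)},…,λ^{(r)}) ∈ S(r,m)} q^{Σ_{i=1}^r |λ^{(i)}|} = Σ_{ρ_1,…,ρ_r ≥ 0} q^{Σ_{i=1}^r ρ_i(ρ_i+1)/2} · (1/(q)_{ρ_1}) · ∏_{i=1}^{r−1} [ρ_i + δ_{i,r−m}, ρ_{i+1}]_q, where the sum on the right is over all r-tuples of nonnegative integers and δ is the Kronecker delta. -/

import Mathlib

open PowerSeries

noncomputable section

/-- The product (coefficientwise) topology on `ℚ⟦X⟧`. -/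
instance : TopologicalSpace ℚ⟦X⟧ :=
  inferInstanceAs (TopologicalSpace ((Unit →₀ ℕ) → ℚ))

/-- `(q)_n = ∏_{i=1}^n (1 - q^i)` in `ℚ⟦X⟧`. -/
def qp (n : ℕ) : ℚ⟦X⟧ := ∏ i ∈ Finset.range n, (1 - X ^ (i + 1))

/-- `(-q)_n = ∏_{i=1}^n (1 + q^i)` in `ℚ⟦X⟧`. -/
def nqp (n : ℕ) : ℚ⟦X⟧ := ∏ i ∈ Finset.range n, (1 + X ^ (i + 1))

/-- The Gaussian binomial `[M, N]_q`, zero unless `M ≥ N`. -/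
def qbinom (M N : ℕ) : ℚ⟦X⟧ :=
  if N ≤ M then qp M * ((qp N)⁻¹ * (qp (M - N))⁻¹) else 0

/-- Weakly decreasing tuples `f 0 ≥ f 1 ≥ … ≥ f (r-1) ≥ 0`, encoded as
antitone functions `ℕ → ℕ` vanishing from index `r` on. -/
def DecTuple (r : ℕ) : Type :=
  {f : ℕ → ℕ // (∀ ⦃i j : ℕ⦄, i ≤ j → f j ≤ f i) ∧ ∀ i, r ≤ i → f i = 0}

/-- `(q)_λ = (q)_{λ_1-λ_2} ⋯ (q)_{λ_{r-1}-λ_r} (q)_{λ_r}` for a weakly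
decreasing tuple `λ` (0-indexed). -/
def qpT (r : ℕ) (f : ℕ → ℕ) : ℚ⟦X⟧ := ∏ i ∈ Finset.range r, qp (f i - f (i + 1))


/-- Tuples `(λ^(1), …, λ^(r))` of distinct-part partitions (a distinct-part
partition being encoded as its finite set of (positive) parts, `L i` encoding
`λ^(i+1)`) satisfying `λ^(i)_1 ≤ l(λ^(i+1)) + δ_{i,m}` for `1 ≤ i ≤ r-1`;
here `(L i).sup id` is the largest part and `(L i).card` the number of parts. -/
def Srm (r m : ℕ) : Set (ℕ → Finset ℕ) :=
  {L | (∀ i, r ≤ i → L i = ∅) ∧ (∀ i, 0 ∉ L i) ∧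
    ∀ i, i + 2 ≤ r → (L i).sup id ≤ (L (i + 1)).card + if i + 1 = m then 1 else 0}

/-- The subset `S(r,m)_n` of `S(r,m)` where the total size is `n`. -/
def Srmn (r m n : ℕ) : Set (ℕ → Finset ℕ) :=
  {L ∈ Srm r m | ∑ i ∈ Finset.range r, (L i).sum id = n}

/-- Arbitrary `r`-tuples of naturals, encoded as functions `ℕ → ℕ` vanishing
from index `r` on. -/
def FinTuple (r : ℕ) : Type := {g : ℕ → ℕ // ∀ i, r ≤ i → g i = 0}

lemma qp_succ (n : ℕ) : qp (n + 1) = qp n * (1 - X ^ (n + 1)) :=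
  Finset.prod_range_succ _ _

lemma constantCoeff_qp (n : ℕ) : constantCoeff (qp n) = 1 := by
  simp [qp, map_prod]

lemma qp_ne_zero (n : ℕ) : qp n ≠ 0 := fun h => by
  simpa [h] using constantCoeff_qp n

lemma qp_mul_inv (n : ℕ) : qp n * (qp n)⁻¹ = 1 :=
  PowerSeries.mul_inv_cancel _ (by simp [constantCoeff_qp])

lemma qbinom_of_lt {M N : ℕ} (h : M < N) : qbinom M N = 0 := if_neg h.not_ge

lemma qbinom_add_mul (N d : ℕ) : qbinom (N + d) N * (qp N * qp d) = qp (N + d) := by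
  rw [qbinom, if_pos (Nat.le_add_right N d), Nat.add_sub_cancel_left]
  linear_combination qp (N + d) * qp d * (qp d)⁻¹ * qp_mul_inv N + qp (N + d) * qp_mul_inv d

lemma qbinom_self (N : ℕ) : qbinom N N = 1 := by
  have h := qbinom_add_mul N 0
  have h0 : qp 0 = 1 := by simp [qp]
  rw [add_zero, h0, mul_one] at h
  exact mul_right_cancel₀ (qp_ne_zero N) (by rw [h, one_mul])

lemma qbinom_zero_right (N : ℕ) : qbinom N 0 = 1 := by
  have h := qbinom_add_mul 0 N
  have h0 : qp 0 = 1 := by simp [qp]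
  rw [zero_add, h0, one_mul] at h
  exact mul_right_cancel₀ (qp_ne_zero N) (by rw [h, one_mul])

/-- The `q`-Pascal rule. -/
lemma qbinom_succ_succ {M N : ℕ} (h : N ≤ M) :
    qbinom (M + 1) (N + 1) = qbinom M (N + 1) + X ^ (M - N) * qbinom M N := by
  obtain ⟨d, rfl⟩ := Nat.exists_eq_add_of_le h
  rw [Nat.add_sub_cancel_left]
  cases d with
  | zero => simp [qbinom_self, qbinom_of_lt]
  | succ d =>
    refine mul_right_cancel₀ (mul_ne_zero (qp_ne_zero (N + 1)) (qp_ne_zero (d + 1))) ?_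
    have h1 := qbinom_add_mul (N + 1) (d + 1)
    have h2 := qbinom_add_mul (N + 1) d
    have h3 := qbinom_add_mul N (d + 1)
    rw [show N + 1 + (d + 1) = N + (d + 1) + 1 by ring, qp_succ (N + (d + 1))] at h1
    rw [show N + 1 + d = N + (d + 1) by ring] at h2
    rw [h1, qp_succ d, qp_succ N]
    rw [qp_succ N] at h2
    rw [qp_succ d] at h3
    rw [show N + (d + 1) + 1 = (N + 1) + (d + 1) by ring, pow_add]
    linear_combination (-(1 - X ^ (d + 1))) * h2 - X ^ (d + 1) * (1 - X ^ (N + 1)) * h3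

/-- The generating function of the `N`-element subsets of `{1, …, M}` by sum of elements. -/
lemma sum_powersetCard_X_pow (M N : ℕ) :
    ∑ s ∈ Finset.powersetCard N (Finset.Icc 1 M), (X : ℚ⟦X⟧) ^ s.sum id =
      X ^ (N * (N + 1) / 2) * qbinom M N := by
  induction M generalizing N with
  | zero =>
    cases N with
    | zero => simp [qbinom_self]
    | succ N =>
      rw [Finset.powersetCard_eq_empty.2 (by simp), qbinom_of_lt N.succ_pos,
        Finset.sum_empty, mul_zero]
  | succ M ih =>
    cases N with
    | zero => simp [qbinom_zero_right]
    | succ N =>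
      have hM : M + 1 ∉ Finset.Icc 1 M := by simp
      rw [← Finset.insert_Icc_right_eq_Icc_add_one (by omega),
        Finset.powersetCard_succ_insert hM, Finset.sum_union, ih (N + 1), Finset.sum_image]
      · have key : ∀ s ∈ Finset.powersetCard N (Finset.Icc 1 M),
            (X : ℚ⟦X⟧) ^ (insert (M + 1) s).sum id = X ^ (M + 1) * X ^ s.sum id := by
          intro s hs
          rw [Finset.sum_insert fun h => hM ((Finset.mem_powersetCard.1 hs).1 h), pow_add, id]
        rw [Finset.sum_congr rfl key, ← Finset.mul_sum, ih]
        rcases lt_or_ge M N with h | h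
        · rw [qbinom_of_lt h, qbinom_of_lt (by omega : M < N + 1),
            qbinom_of_lt (by omega : M + 1 < N + 1)]
          ring
        · have hexp : (N + 1) * (N + 1 + 1) / 2 + (M - N) = M + 1 + N * (N + 1) / 2 := by
            rw [show (N + 1) * (N + 1 + 1) = N * (N + 1) + 2 * (N + 1) by ring,
              Nat.add_mul_div_left _ _ two_pos]
            omega
          have hX : (X : ℚ⟦X⟧) ^ ((N + 1) * (N + 1 + 1) / 2) * X ^ (M - N) =
              X ^ (M + 1) * X ^ (N * (N + 1) / 2) := by rw [← pow_add, ← pow_add, hexp]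
          rw [qbinom_succ_succ h]
          linear_combination (-qbinom M N) * hX
      · intro s hs t ht hst
        rw [← Finset.erase_insert fun h => hM ((Finset.mem_powersetCard.1 hs).1 h), hst,
          Finset.erase_insert fun h => hM ((Finset.mem_powersetCard.1 ht).1 h)]
      · rw [Finset.disjoint_right]
        intro s hs hs'
        obtain ⟨t, -, rfl⟩ := Finset.mem_image.1 hs
        exact hM ((Finset.mem_powersetCard.1 hs').1 (Finset.mem_insert_self _ _))

/-- `[n + N, N]_q` agrees with `1 / (q)_N` up to order `n`. -/
lemma X_pow_dvd_qbinom_sub_inv (n N : ℕ) :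
    (X : ℚ⟦X⟧) ^ (n + 1) ∣ qbinom (N + n) N - (qp N)⁻¹ := by
  have h : (X : ℚ⟦X⟧) ^ (n + 1) ∣ qp (n + N) - qp n := by
    induction N with
    | zero => simp
    | succ N ih =>
      rw [← add_assoc, qp_succ,
        show qp (n + N) * (1 - X ^ (n + N + 1)) - qp n =
          (qp (n + N) - qp n) - X ^ (n + 1) * (X ^ N * qp (n + N)) by ring]
      exact dvd_sub ih (dvd_mul_right _ _)
  rw [qbinom, if_pos (Nat.le_add_right N n), Nat.add_sub_cancel_left, add_comm N n]
  convert h.mul_right ((qp N)⁻¹ * (qp n)⁻¹) using 1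
  linear_combination (qp N)⁻¹ * qp_mul_inv n

lemma hasSum_of_coeff {ι : Type*} {f : ι → ℚ⟦X⟧} {a : ℚ⟦X⟧}
    (h : ∀ n, HasSum (fun i => coeff n (f i)) (coeff n a)) : HasSum f a :=
  (PowerSeries.WithPiTopology.hasSum_iff_hasSum_coeff (R := ℚ)).2 h

instance : T2Space ℚ⟦X⟧ := inferInstanceAs (T2Space ((Unit →₀ ℕ) → ℚ))

instance : RegularSpace ℚ⟦X⟧ := inferInstanceAs (RegularSpace ((Unit →₀ ℕ) → ℚ))

instance : ContinuousAdd ℚ⟦X⟧ := inferInstanceAs (ContinuousAdd ((Unit →₀ ℕ) → ℚ))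

/-- The entries of a tuple in `S(r,m)`, indexed by `Fin r`. -/
def Srm.restrict {r m : ℕ} (L : Srm r m) (i : Fin r) : Finset ℕ := L.1 i

lemma Srm.restrict_injective {r m : ℕ} : Function.Injective (Srm.restrict (r := r) (m := m)) := by
  intro L L' h
  refine Subtype.ext (funext fun i => ?_)
  rcases lt_or_ge i r with hi | hi
  · exact congrFun h ⟨i, hi⟩
  · rw [L.2.1 i hi, L'.2.1 i hi]

lemma Srm.le_weight {r m : ℕ} (L : Srm r m) {i x : ℕ} (hx : x ∈ L.1 i) :
    x ≤ ∑ j ∈ Finset.range r, (L.1 j).sum id := by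
  have hi : i < r := by
    by_contra hi
    simp [L.2.1 i (not_lt.1 hi)] at hx
  exact (Finset.single_le_sum (f := id) (fun _ _ => Nat.zero_le _) hx).trans
    (Finset.single_le_sum (f := fun j => (L.1 j).sum id) (fun _ _ => Nat.zero_le _)
      (Finset.mem_range.2 hi))

lemma Srm.finite_weight_eq (r m n : ℕ) :
    {L : Srm r m | ∑ i ∈ Finset.range r, (L.1 i).sum id = n}.Finite := by
  refine Set.Finite.of_finite_image (f := Srm.restrict) ?_ Srm.restrict_injective.injOn
  refine (Finset.finite_toSet
    (Fintype.piFinset fun _ : Fin r => (Finset.range (n + 1)).powerset)).subset ?_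
  rintro _ ⟨L, hL, rfl⟩
  simp only [Finset.mem_coe, Fintype.mem_piFinset, Finset.mem_powerset]
  intro i x hx
  rw [Finset.mem_range, Nat.lt_succ_iff, ← show _ = n from hL]
  exact Srm.le_weight L hx

lemma Srm.summable (r m : ℕ) :
    Summable fun L : Srm r m => (X : ℚ⟦X⟧) ^ ∑ i ∈ Finset.range r, (L.1 i).sum id := by
  refine (PowerSeries.WithPiTopology.summable_iff_summable_coeff (R := ℚ)).2 fun n => ?_
  refine summable_of_hasFiniteSupport ((Srm.finite_weight_eq r m n).subset fun L hL => ?_)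
  rw [Function.mem_support, coeff_X_pow] at hL
  exact by_contra fun h => hL (if_neg (Ne.symm h))

/-- The numbers of parts of the entries of a tuple in `S(k+1,m)`, in reverse order. -/
def Srm.lengths {k m : ℕ} (L : Srm (k + 1) m) : FinTuple (k + 1) :=
  ⟨fun t => if t ≤ k then (L.1 (k - t)).card else 0, fun t ht => if_neg (by omega)⟩

lemma Srm.card_of_lengths_eq {k m : ℕ} {L : Srm (k + 1) m} {g : FinTuple (k + 1)}
    (h : Srm.lengths L = g) {i : ℕ} (hi : i ≤ k) : (L.1 i).card = g.1 (k - i) := by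
  subst h
  change _ = if k - i ≤ k then (L.1 (k - (k - i))).card else 0
  rw [if_pos (Nat.sub_le k i), Nat.sub_sub_self hi]

/-- The bound on the parts of the `i`-th entry of a tuple in `S(k+1,m)` with part counts `g`
(in reverse order), where the parts of the last entry are bounded by `g 0 + n`. -/
def partBound (k m n : ℕ) (g : ℕ → ℕ) (i : ℕ) : ℕ :=
  if i < k then g (k - (i + 1)) + if i + 1 = m then 1 else 0 else g 0 + n

/-- The tuples of subsets of `{1, …, partBound k m n g i}` with part counts `g`. -/
def boundedTuples (k m n : ℕ) (g : ℕ → ℕ) : Finset (Fin (k + 1) → Finset ℕ) :=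
  Fintype.piFinset fun i =>
    Finset.powersetCard (g (k - i)) (Finset.Icc 1 (partBound k m n g i))

lemma sum_boundedTuples {k m : ℕ} (hm : m ≤ k) (n : ℕ) (g : ℕ → ℕ) :
    ∑ x ∈ boundedTuples k m n g, (X : ℚ⟦X⟧) ^ ∑ i, (x i).sum id =
      X ^ (∑ i ∈ Finset.range (k + 1), g i * (g i + 1) / 2) *
        (qbinom (g 0 + n) (g 0) *
          ∏ t ∈ Finset.range k, qbinom (g t + if t + 1 = k + 1 - m then 1 else 0) (g (t + 1))) := by
  simp only [← Finset.prod_pow_eq_pow_sum Finset.univ,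
    ← Finset.prod_pow_eq_pow_sum (Finset.range _)]
  rw [boundedTuples,
    ← Finset.prod_univ_sum (κ := fun _ => Finset ℕ) _ fun _ s => (X : ℚ⟦X⟧) ^ s.sum id]
  simp only [sum_powersetCard_X_pow]
  rw [Finset.prod_mul_distrib,
    Fin.prod_univ_eq_prod_range (fun i => (X : ℚ⟦X⟧) ^ (g (k - i) * (g (k - i) + 1) / 2)),
    Fin.prod_univ_eq_prod_range (fun i => qbinom (partBound k m n g i) (g (k - i)))]
  congr 1
  · exact Finset.prod_range_reflect (fun i => (X : ℚ⟦X⟧) ^ (g i * (g i + 1) / 2)) (k + 1)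
  · rw [Finset.prod_range_succ, mul_comm]
    congr 1
    · simp [partBound]
    · rw [← Finset.prod_range_reflect]
      refine Finset.prod_congr rfl fun t ht => ?_
      have ht := Finset.mem_range.1 ht
      rw [partBound, if_pos (by omega), show k - (k - 1 - t + 1) = t by omega,
        show k - (k - 1 - t) = t + 1 by omega]
      congr 2
      exact if_congr (by omega) rfl rfl

lemma Srm.restrict_mem_boundedTuples {k m n : ℕ} {L : Srm (k + 1) m} {g : FinTuple (k + 1)}
    (h : Srm.lengths L = g) (hn : ∑ i ∈ Finset.range (k + 1), (L.1 i).sum id = n) :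
    Srm.restrict L ∈ boundedTuples k m n g.1 := by
  refine Fintype.mem_piFinset.2 fun i => Finset.mem_powersetCard.2
    ⟨fun x hx => Finset.mem_Icc.2 ⟨?_, ?_⟩, Srm.card_of_lengths_eq h (by omega)⟩
  · exact Nat.one_le_iff_ne_zero.2 fun h0 => L.2.2.1 i (h0 ▸ hx)
  · rcases lt_or_ge (i : ℕ) k with hi | hi
    · rw [partBound, if_pos hi, ← Srm.card_of_lengths_eq h hi]
      exact (Finset.le_sup (f := id) (show x ∈ L.1 i from hx)).trans (L.2.2.2 i (by omega))
    · rw [partBound, if_neg hi.not_gt, ← hn]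
      exact (Srm.le_weight L hx).trans (Nat.le_add_left _ _)

lemma exists_restrict_eq_of_mem_boundedTuples {k m n : ℕ} {g : FinTuple (k + 1)}
    {x : Fin (k + 1) → Finset ℕ} (hx : x ∈ boundedTuples k m n g.1) :
    ∃ L : Srm (k + 1) m, Srm.lengths L = g ∧ Srm.restrict L = x := by
  have hx' := fun i => Finset.mem_powersetCard.1 (Fintype.mem_piFinset.1 hx i)
  let f : ℕ → Finset ℕ := fun i => if h : i < k + 1 then x ⟨i, h⟩ else ∅
  have hf : ∀ i (h : i < k + 1), f i = x ⟨i, h⟩ := fun i h => dif_pos h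
  have hf' : ∀ i, k + 1 ≤ i → f i = ∅ := fun i h => dif_neg h.not_gt
  have hcard : ∀ i, i < k + 1 → (f i).card = g.1 (k - i) := fun i h => by
    rw [hf i h, (hx' ⟨i, h⟩).2]
  refine ⟨⟨f, hf', fun i hi => ?_, fun i hi => ?_⟩, ?_, ?_⟩
  · rcases lt_or_ge i (k + 1) with h | h
    · rw [hf i h] at hi
      simpa using (hx' ⟨i, h⟩).1 hi
    · simp [hf' i h] at hi
  · rw [hf i (by omega), hcard (i + 1) (by omega)]
    refine Finset.sup_le fun y hy => ?_
    have := (Finset.mem_Icc.1 ((hx' _).1 hy)).2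
    rwa [partBound, if_pos (show i < k by omega)] at this
  · refine Subtype.ext (funext fun t => ?_)
    change (if t ≤ k then (f (k - t)).card else 0) = g.1 t
    split_ifs with ht
    · rw [hcard _ (by omega), Nat.sub_sub_self ht]
    · exact (g.2 t (by omega)).symm
  · exact funext fun i => hf i i.2

/-- The generating function of the tuples in `S(k+1,m)` with prescribed part counts. -/
lemma Srm.hasSum_lengths_eq {k m : ℕ} (hm : m ≤ k) (g : FinTuple (k + 1)) :
    HasSum (fun L : {L : Srm (k + 1) m // Srm.lengths L = g} =>
        (X : ℚ⟦X⟧) ^ ∑ i ∈ Finset.range (k + 1), (L.1.1 i).sum id)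
      (X ^ (∑ i ∈ Finset.range (k + 1), g.1 i * (g.1 i + 1) / 2) *
        ((qp (g.1 0))⁻¹ * ∏ t ∈ Finset.range k,
          qbinom (g.1 t + if t + 1 = k + 1 - m then 1 else 0) (g.1 (t + 1)))) := by
  refine hasSum_of_coeff fun n => ?_
  have hinj : Function.Injective fun L : {L : Srm (k + 1) m // Srm.lengths L = g} =>
      Srm.restrict L.1 :=
    Srm.restrict_injective.comp Subtype.val_injective
  have hcoeff := X_pow_dvd_iff.1
    (((X_pow_dvd_qbinom_sub_inv n (g.1 0)).mul_left
      (X ^ (∑ i ∈ Finset.range (k + 1), g.1 i * (g.1 i + 1) / 2))).mul_right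
      (∏ t ∈ Finset.range k,
        qbinom (g.1 t + if t + 1 = k + 1 - m then 1 else 0) (g.1 (t + 1)))) n n.lt_succ_self
  rw [mul_sub, sub_mul, map_sub, sub_eq_zero, mul_assoc, mul_assoc,
    ← sum_boundedTuples hm, map_sum] at hcoeff
  rw [← hcoeff, ← Finset.sum_preimage _ _ hinj.injOn]
  · have hw (L : Srm (k + 1) m) : ∑ i, (Srm.restrict L i).sum id =
        ∑ i ∈ Finset.range (k + 1), (L.1 i).sum id :=
      Fin.sum_univ_eq_sum_range (fun i => (L.1 i).sum id) (k + 1)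
    simp only [hw]
    refine hasSum_sum_of_ne_finset_zero fun L hL => ?_
    rw [coeff_X_pow]
    refine if_neg fun hn => hL (Finset.mem_preimage.2 ?_)
    exact Srm.restrict_mem_boundedTuples L.2 hn.symm
  · intro x hx hx'
    obtain ⟨L, hL, rfl⟩ := exists_restrict_eq_of_mem_boundedTuples hx
    exact absurd ⟨⟨L, hL⟩, rfl⟩ hx'

/-- `Σ_{S(r,m)} q^{Σ|λ^{(i)}|} = Σ_{ρ_1,…,ρ_r ≥ 0} q^{Σ ρ_i(ρ_i+1)/2} ·
(q)_{ρ_1}⁻¹ · ∏_{i=1}^{r-1} [ρ_i + δ_{i,r-m}, ρ_{i+1}]_q`  (`g.1 t` is `ρ_{t+1}`). -/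
theorem stmt2 (r m : ℕ) (hr : 1 ≤ r) (hm : m ≤ r - 1) :
    (∑' L : Srm r m, (X : ℚ⟦X⟧) ^ ∑ i ∈ Finset.range r, (L.1 i).sum id) =
      ∑' g : FinTuple r,
        (X : ℚ⟦X⟧) ^ (∑ i ∈ Finset.range r, g.1 i * (g.1 i + 1) / 2) *
          ((qp (g.1 0))⁻¹ *
            ∏ t ∈ Finset.range (r - 1),
              qbinom (g.1 t + if t + 1 = r - m then 1 else 0) (g.1 (t + 1))) := by
  obtain ⟨k, rfl⟩ := Nat.exists_eq_add_of_le' hr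
  rw [Nat.add_sub_cancel] at hm ⊢
  have h := (Equiv.sigmaFiberEquiv (Srm.lengths (k := k) (m := m))).hasSum_iff.2
    (Srm.summable (k + 1) m).hasSum
  exact (h.sigma fun g => Srm.hasSum_lengths_eq hm g).tsum_eq.symm
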